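/- One-step growth of the heat-kernel approximation error: there exists a constant C > 0 such that for every integer M ≥ 2 (with δx = 1/M), every δt > 0, and every integer ℓ ≥ 1, setting M_ℓ = max_{i,j ∈ ℤ/M} |(Q^ℓ)_{i,j} − ∫_ℝ φ_j(x_i + y) dγ_{ℓδt}(y)|, one has M_{ℓ+1} ≤ M_ℓ + C δx²/(ℓ δt); moreover M_0 = 0 and M_1 = 0. -/

import Mathlib

open MeasureTheory ProbabilityTheory Real Finset

noncomputable section

/-- The 1-periodic hat function associated with the node `x_k = k/M`:
the unique continuous 1-periodic function, affine on each interval between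
consecutive nodes, equal to 1 at `x_k` and 0 at the other nodes. -/
def hatFn (M : ℕ) (k : ZMod M) (x : ℝ) : ℝ :=
  max 0 (1 - (M : ℝ) * |(x - (k.val : ℝ) / M) - ((round (x - (k.val : ℝ) / M) : ℤ) : ℝ)|)

/-- The piecewise linear 1-periodic interpolant of nodal values `u`. -/
def interp (M : ℕ) [NeZero M] (u : ZMod M → ℝ) (x : ℝ) : ℝ :=
  ∑ k : ZMod M, u k * hatFn M k x

/-- Discrete `ℓ²` squared norm: `δx ∑ⱼ uⱼ²` with `δx = 1/M`. -/
def l2sq (M : ℕ) [NeZero M] (u : ZMod M → ℝ) : ℝ :=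
  (1 / M : ℝ) * ∑ j : ZMod M, (u j) ^ 2

/-- Discrete `h¹` squared seminorm: `δx ∑ⱼ ((u_{j+1} - u_j)/δx)²` with `δx = 1/M`. -/
def h1sq (M : ℕ) [NeZero M] (u : ZMod M → ℝ) : ℝ :=
  (1 / M : ℝ) * ∑ j : ZMod M, ((u (j + 1) - u j) / (1 / M : ℝ)) ^ 2

/-- The matrix `Q` with entries `Q j k = ∫ φ_k(x_j + y) dγ_{δt}(y)`, `γ_{δt}` being the
centered Gaussian measure with variance `δt`. -/
def Qmat (M : ℕ) [NeZero M] (δt : ℝ) : Matrix (ZMod M) (ZMod M) ℝ :=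
  fun j k => ∫ y, hatFn M k ((j.val : ℝ) / M + y) ∂(gaussianReal 0 δt.toNNReal)

/-- The random matrix `P` with entries `P j k = φ_k(x_j + √δt G^j)`. -/
def Pmat (M : ℕ) [NeZero M] (δt : ℝ) {Ω : Type} (G : ZMod M → Ω → ℝ) (ω : Ω) :
    Matrix (ZMod M) (ZMod M) ℝ :=
  fun j k => hatFn M k ((j.val : ℝ) / M + Real.sqrt δt * G j ω)

/-- The averaged random matrix `P̄` with entries
`P̄ j k = (1/N) ∑ₘ φ_k(x_j + √δt G^{m,j})`. -/
def Pbar (M : ℕ) [NeZero M] (δt : ℝ) (N : ℕ) {Ω : Type} (G : Fin N × ZMod M → Ω → ℝ)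
    (ω : Ω) : Matrix (ZMod M) (ZMod M) ℝ :=
  fun j k => (1 / N : ℝ) * ∑ m : Fin N, hatFn M k ((j.val : ℝ) / M + Real.sqrt δt * G (m, j) ω)

/-- The sequence of averaged random matrices `P⁽ⁱ⁾` with entries
`P⁽ⁱ⁾ j k = (1/N) ∑ₘ φ_k(x_j + √δt G^{i,m,j})`. -/
def PbarSeq (M : ℕ) [NeZero M] (δt : ℝ) (N : ℕ) {Ω : Type}
    (G : ℕ × Fin N × ZMod M → Ω → ℝ) (i : ℕ) (ω : Ω) : Matrix (ZMod M) (ZMod M) ℝ :=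
  fun j k => (1 / N : ℝ) * ∑ m : Fin N, hatFn M k ((j.val : ℝ) / M + Real.sqrt δt * G (i, m, j) ω)

/-- Descending product `P^{(n-1)} ⋯ P^{(0)}` (with the convention that the empty
product is the identity matrix). -/
def prodDesc {I : Type} [Fintype I] [DecidableEq I] (P : ℕ → Matrix I I ℝ) : ℕ → Matrix I I ℝ
  | 0 => 1
  | n + 1 => P n * prodDesc P n

/-- Descending product starting from index `a`: `prodDescFrom P a s = P^{(a+s-1)} ⋯ P^{(a)}`
(identity for `s = 0`). -/
def prodDescFrom {I : Type} [Fintype I] [DecidableEq I] (P : ℕ → Matrix I I ℝ) (a : ℕ) :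
    ℕ → Matrix I I ℝ
  | 0 => 1
  | s + 1 => P (a + s) * prodDescFrom P a s

end
noncomputable section

/-- The maximal heat-kernel approximation error at step `ℓ`:
`M_ℓ = max_{i,j} |(Q^ℓ)_{i,j} - ∫ φ_j(x_i + y) dγ_{ℓδt}(y)|`. -/
def Merr (M : ℕ) [NeZero M] (δt : ℝ) (ℓ : ℕ) : ℝ :=
  ⨆ i : ZMod M, ⨆ j : ZMod M,
    |(Qmat M δt ^ ℓ) i j
      - ∫ y, hatFn M j ((i.val : ℝ) / M + y) ∂(gaussianReal 0 ((ℓ : ℝ) * δt).toNNReal)|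

lemma hat_meas (M : ℕ) (k : ZMod M) : Measurable (hatFn M k) := by
  unfold hatFn
  simp only [abs_sub_round_eq_min]
  have h : Measurable fun x : ℝ => Int.fract (x - (k.val : ℝ) / M) :=
    measurable_fract.comp (measurable_id.sub_const _)
  exact measurable_const.max (((h.min (h.const_sub 1)).const_mul _).const_sub 1)

lemma hat_nonneg (M : ℕ) (k : ZMod M) (x : ℝ) : 0 ≤ hatFn M k x := le_max_left _ _

lemma hat_le_one (M : ℕ) (k : ZMod M) (x : ℝ) : hatFn M k x ≤ 1 := by
  unfold hatFn
  refine max_le zero_le_one ?_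
  have : 0 ≤ (M : ℝ) * |(x - (k.val : ℝ) / M) - ((round (x - (k.val : ℝ) / M) : ℤ) : ℝ)| := by
    positivity
  linarith

lemma hat_periodic (M : ℕ) (k : ZMod M) : Function.Periodic (hatFn M k) 1 := by
  intro x
  unfold hatFn
  have : x + 1 - (k.val : ℝ) / M = (x - (k.val : ℝ) / M) + 1 := by ring
  rw [this, round_add_one]
  push_cast
  congr 4
  ring

/-- values of the hat functions on a cell -/
lemma hat_cell (M : ℕ) [NeZero M] (hM : 2 ≤ M) (k : ZMod M) (n : ℤ) (θ : ℝ)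
    (h0 : 0 ≤ θ) (h1 : θ < 1) :
    hatFn M k ((n + θ) / M) =
      (1 - θ) * (if k = (n : ZMod M) then 1 else 0)
        + θ * (if k = ((n + 1 : ℤ) : ZMod M) then 1 else 0) := by
  have hMpos : (0 : ℝ) < M := by positivity
  have hMz : (0 : ℤ) < M := by omega
  have hMR : (2 : ℝ) ≤ M := by exact_mod_cast hM
  set m : ℤ := n - k.val with hm
  set r : ℤ := m % M with hr
  have hr0 : 0 ≤ r := Int.emod_nonneg _ hMz.ne'
  have hr1 : r < M := Int.emod_lt_of_pos _ hMz
  have hkc : ((k.val : ℤ) : ZMod M) = k := by simp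
  have hdiv : m = M * (m / M) + r := (Int.mul_ediv_add_emod m M).symm
  have hfr : Int.fract ((n + θ) / M - (k.val : ℝ) / M) = (r + θ) / M := by
    rw [Int.fract_eq_iff]
    refine ⟨by positivity, ?_, m / M, ?_⟩
    · rw [div_lt_one hMpos]
      have : (r : ℝ) + 1 ≤ M := by exact_mod_cast hr1
      linarith
    · have h2 : (n : ℝ) - k.val = M * ((m / M : ℤ) : ℝ) + r := by
        have := congrArg (fun z : ℤ => (z : ℝ)) hdiv
        push_cast [hm] at this
        simpa [hm] using this
      have h3 : (n : ℝ) = k.val + M * ((m / M : ℤ) : ℝ) + r := by linarith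
      rw [h3]
      field_simp
      ring
  have hA : k = (n : ZMod M) ↔ r = 0 := by
    rw [hr, ← Int.dvd_iff_emod_eq_zero, ← ZMod.intCast_zmod_eq_zero_iff_dvd, hm]
    push_cast
    rw [sub_eq_zero]
    simp [eq_comm]
  have hB : k = ((n + 1 : ℤ) : ZMod M) ↔ r = M - 1 := by
    have : k = ((n + 1 : ℤ) : ZMod M) ↔ (M : ℤ) ∣ m + 1 := by
      rw [← ZMod.intCast_zmod_eq_zero_iff_dvd, hm]
      push_cast
      rw [sub_add_eq_add_sub, sub_eq_zero]
      simp [eq_comm]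
    rw [this]
    have h4 : m + 1 = M * (m / M) + (r + 1) := by omega
    rw [h4, Int.dvd_add_right (Dvd.intro _ rfl)]
    constructor
    · intro h
      have := Int.le_of_dvd (by omega) h
      omega
    · intro h
      rw [h]; simp
  unfold hatFn
  rw [abs_sub_round_eq_min, hfr]
  have hmin : (M : ℝ) * min ((r + θ) / M) (1 - (r + θ) / M) = min (r + θ) (M - (r + θ)) := by
    rw [mul_min_of_nonneg _ _ hMpos.le]
    congr 1 <;> field_simp
  rw [hmin]
  simp only [hA, hB]
  rcases eq_or_ne r 0 with h | h
  · have h' : ¬ (r = M - 1) := by omega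
    rw [if_pos h, if_neg h', h]
    rw [min_eq_left (by push_cast; linarith), max_eq_right (by push_cast; linarith)]
    push_cast; ring
  · rcases eq_or_ne r (M - 1) with h' | h'
    · rw [if_neg h, if_pos h', h']
      rw [min_eq_right (by push_cast; linarith), max_eq_right (by push_cast; linarith)]
      push_cast; ring
    · rw [if_neg h, if_neg h']
      have e1 : (1 : ℝ) ≤ r := by exact_mod_cast (by omega : 1 ≤ r)
      have e2 : (r : ℝ) + 2 ≤ M := by exact_mod_cast (by omega : r + 2 ≤ M)
      rw [max_eq_left]
      · ring
      · have : (1 : ℝ) ≤ min (r + θ) (M - (r + θ)) := le_min (by linarith) (by linarith)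
        linarith

lemma sum_hat_cell (M : ℕ) [NeZero M] (hM : 2 ≤ M) (u : ZMod M → ℝ) (n : ℤ) (θ : ℝ)
    (h0 : 0 ≤ θ) (h1 : θ < 1) :
    ∑ k, hatFn M k ((n + θ) / M) * u k =
      (1 - θ) * u (n : ZMod M) + θ * u ((n + 1 : ℤ) : ZMod M) := by
  simp only [hat_cell M hM _ n θ h0 h1, add_mul, Finset.sum_add_distrib, mul_assoc,
    ite_mul, one_mul, zero_mul, ← Finset.mul_sum]
  simp

lemma exists_cell (M : ℕ) [NeZero M] (x : ℝ) :
    ∃ (n : ℤ) (θ : ℝ), 0 ≤ θ ∧ θ < 1 ∧ x = (n + θ) / M := by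
  have hMpos : (0 : ℝ) < M := by have := NeZero.ne M; positivity
  refine ⟨⌊M * x⌋, Int.fract (M * x), Int.fract_nonneg _, Int.fract_lt_one _, ?_⟩
  rw [Int.floor_add_fract]
  field_simp

lemma sum_hat (M : ℕ) [NeZero M] (hM : 2 ≤ M) (x : ℝ) : ∑ k, hatFn M k x = 1 := by
  obtain ⟨n, θ, h0, h1, rfl⟩ := exists_cell M x
  have := sum_hat_cell M hM (fun _ => 1) n θ h0 h1
  simpa using this

lemma node_val (M : ℕ) [NeZero M] (u : ℝ → ℝ) (hu : Function.Periodic u 1) (n : ℤ) :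
    u (((n : ZMod M).val : ℝ) / M) = u (n / M) := by
  have hMpos : (0 : ℝ) < M := by have := NeZero.ne M; positivity
  have h : (((n : ZMod M).val : ℕ) : ℤ) = n % M := ZMod.val_intCast n
  have h2 : (n : ℝ) = (((n : ZMod M).val : ℕ) : ℝ) + M * ((n / M : ℤ) : ℝ) := by
    have h3 := Int.mul_ediv_add_emod n M
    rw [← h] at h3
    have := congrArg (fun z : ℤ => (z : ℝ)) h3
    push_cast at this
    linarith
  conv_rhs => rw [h2]
  have := (hu.int_mul (n / M)) (((n : ZMod M).val : ℝ) / M)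
  rw [← this]
  congr 1
  field_simp

/-- integrability of bounded measurable functions -/
lemma bdd_int {μ : Measure ℝ} [IsFiniteMeasure μ] {f : ℝ → ℝ} (hf : Measurable f)
    (h0 : ∀ x, 0 ≤ f x) (h1 : ∀ x, f x ≤ 1) : Integrable f μ :=
  Integrable.of_bound hf.aestronglyMeasurable 1
    (Filter.Eventually.of_forall fun x => by
      rw [Real.norm_eq_abs, abs_of_nonneg (h0 x)]; exact h1 x)

/-- Gaussian smoothing -/
def smooth (f : ℝ → ℝ) (v : NNReal) (x : ℝ) : ℝ := ∫ y, f (x + y) ∂(gaussianReal 0 v)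

/-- Cameron-Martin shift. -/
lemma smooth_shift (f : ℝ → ℝ) (v : NNReal) (hv : v ≠ 0) (x h : ℝ) :
    smooth f v (x + h) =
      ∫ y, Real.exp (h / v * y - h ^ 2 / (2 * v)) * f (x + y) ∂(gaussianReal 0 v) := by
  have hv' : (v : ℝ) ≠ 0 := by exact_mod_cast hv
  unfold smooth
  rw [integral_gaussianReal_eq_integral_smul hv, integral_gaussianReal_eq_integral_smul hv,
    ← integral_add_right_eq_self
      (fun y => gaussianPDFReal 0 v y • (Real.exp (h / v * y - h ^ 2 / (2 * v)) * f (x + y))) h]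
  congr 1
  ext y
  simp only [gaussianPDFReal, smul_eq_mul]
  have : x + h + y = x + (y + h) := by ring
  rw [this]
  have e : Real.exp (-(y - 0) ^ 2 / (2 * v)) =
      Real.exp (-(y + h - 0) ^ 2 / (2 * v)) * Real.exp (h / v * (y + h) - h ^ 2 / (2 * v)) := by
    rw [← Real.exp_add]
    congr 1
    field_simp
    ring
  rw [e]
  ring

lemma W_int (v : NNReal) (h : ℝ) :
    Integrable (fun y => Real.exp (h / v * y - h ^ 2 / (2 * v))) (gaussianReal 0 v) := by
  simp only [Real.exp_sub]
  exact (integrable_exp_mul_gaussianReal (h / v)).div_const _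

lemma W_integral (v : NNReal) (t c : ℝ) :
    ∫ y, Real.exp (t * y - c) ∂(gaussianReal 0 v) = Real.exp (v * t ^ 2 / 2 - c) := by
  have := congrFun (mgf_id_gaussianReal (μ := 0) (v := v)) t
  simp only [mgf, id, zero_mul, zero_add] at this
  simp only [Real.exp_sub, integral_div, this]

lemma smooth_nonneg {f : ℝ → ℝ} (h0 : ∀ x, 0 ≤ f x) (v : NNReal) (x : ℝ) : 0 ≤ smooth f v x :=
  integral_nonneg fun _ => h0 _

lemma smooth_le_one {f : ℝ → ℝ} (hf : Measurable f) (h0 : ∀ x, 0 ≤ f x) (h1 : ∀ x, f x ≤ 1)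
    (v : NNReal) (x : ℝ) : smooth f v x ≤ 1 := by
  have : smooth f v x ≤ ∫ _, (1 : ℝ) ∂(gaussianReal 0 v) :=
    integral_mono (bdd_int (hf.comp (measurable_const_add x)) (fun _ => h0 _) (fun _ => h1 _))
      (integrable_const _) (fun _ => h1 _)
  simpa using this

lemma integral_six {μ : Measure ℝ} {F1 F2 F3 F4 F5 F6 : ℝ → ℝ} (i1 : Integrable F1 μ)
    (i2 : Integrable F2 μ) (i3 : Integrable F3 μ) (i4 : Integrable F4 μ) (i5 : Integrable F5 μ)
    (i6 : Integrable F6 μ) :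
    ∫ y, (F1 y + F2 y + F3 y - F4 y - F5 y + F6 y) ∂μ =
      ∫ y, F1 y ∂μ + ∫ y, F2 y ∂μ + ∫ y, F3 y ∂μ - ∫ y, F4 y ∂μ - ∫ y, F5 y ∂μ + ∫ y, F6 y ∂μ := by
  change ∫ y, (F1 + F2 + F3 - F4 - F5 + F6) y ∂μ = _
  rw [integral_add' ((((i1.add i2).add i3).sub i4).sub i5) i6,
    integral_sub' (((i1.add i2).add i3).sub i4) i5, integral_sub' ((i1.add i2).add i3) i4,
    integral_add' (i1.add i2) i3, integral_add' i1 i2]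

/-- second moment of the interpolated density ratio minus one -/
lemma W_second (v : NNReal) (hv : v ≠ 0) (a b θ : ℝ) :
    Integrable (fun y => ((1 - θ) * Real.exp (a / v * y - a ^ 2 / (2 * v))
        + θ * Real.exp (b / v * y - b ^ 2 / (2 * v)) - 1) ^ 2) (gaussianReal 0 v) ∧
    ∫ y, ((1 - θ) * Real.exp (a / v * y - a ^ 2 / (2 * v))
        + θ * Real.exp (b / v * y - b ^ 2 / (2 * v)) - 1) ^ 2 ∂(gaussianReal 0 v) =
      (1 - θ) ^ 2 * Real.exp (a ^ 2 / v) + θ ^ 2 * Real.exp (b ^ 2 / v)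
        + 2 * (1 - θ) * θ * Real.exp (a * b / v) - 1 := by
  have hv' : (v : ℝ) ≠ 0 := by exact_mod_cast hv
  have I : ∀ t c : ℝ, Integrable (fun y => Real.exp (t * y - c)) (gaussianReal 0 v) := by
    intro t c
    simp only [Real.exp_sub]
    exact (integrable_exp_mul_gaussianReal t).div_const _
  have hE : (fun y : ℝ => ((1 - θ) * Real.exp (a / v * y - a ^ 2 / (2 * v))
        + θ * Real.exp (b / v * y - b ^ 2 / (2 * v)) - 1) ^ 2) = fun y =>
      (1 - θ) ^ 2 * Real.exp ((2 * a / v) * y - a ^ 2 / v)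
      + θ ^ 2 * Real.exp ((2 * b / v) * y - b ^ 2 / v)
      + 2 * (1 - θ) * θ * Real.exp (((a + b) / v) * y - (a ^ 2 + b ^ 2) / (2 * v))
      - 2 * (1 - θ) * Real.exp (a / v * y - a ^ 2 / (2 * v))
      - 2 * θ * Real.exp (b / v * y - b ^ 2 / (2 * v)) + 1 := by
    ext y
    have e1 : Real.exp ((2 * a / v) * y - a ^ 2 / v) =
        Real.exp (a / v * y - a ^ 2 / (2 * v)) * Real.exp (a / v * y - a ^ 2 / (2 * v)) := by
      rw [← Real.exp_add]; congr 1; field_simp; ring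
    have e2 : Real.exp ((2 * b / v) * y - b ^ 2 / v) =
        Real.exp (b / v * y - b ^ 2 / (2 * v)) * Real.exp (b / v * y - b ^ 2 / (2 * v)) := by
      rw [← Real.exp_add]; congr 1; field_simp; ring
    have e3 : Real.exp (((a + b) / v) * y - (a ^ 2 + b ^ 2) / (2 * v)) =
        Real.exp (a / v * y - a ^ 2 / (2 * v)) * Real.exp (b / v * y - b ^ 2 / (2 * v)) := by
      rw [← Real.exp_add]; congr 1; field_simp; ring
    rw [e1, e2, e3]; ring
  rw [hE]
  have i1 := (I (2 * a / v) (a ^ 2 / v)).const_mul ((1 - θ) ^ 2)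
  have i2 := (I (2 * b / v) (b ^ 2 / v)).const_mul (θ ^ 2)
  have i3 := (I ((a + b) / v) ((a ^ 2 + b ^ 2) / (2 * v))).const_mul (2 * (1 - θ) * θ)
  have i4 := (I (a / v) (a ^ 2 / (2 * v))).const_mul (2 * (1 - θ))
  have i5 := (I (b / v) (b ^ 2 / (2 * v))).const_mul (2 * θ)
  refine ⟨((((i1.add i2).add i3).sub i4).sub i5).add (integrable_const 1), ?_⟩
  rw [integral_six i1 i2 i3 i4 i5 (integrable_const 1)]
  simp only [integral_const_mul, W_integral]
  have f1 : (v : ℝ) * (2 * a / v) ^ 2 / 2 - a ^ 2 / v = a ^ 2 / v := by field_simp; ring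
  have f2 : (v : ℝ) * (2 * b / v) ^ 2 / 2 - b ^ 2 / v = b ^ 2 / v := by field_simp; ring
  have f3 : (v : ℝ) * ((a + b) / v) ^ 2 / 2 - (a ^ 2 + b ^ 2) / (2 * v) = a * b / v := by
    field_simp; ring
  have f4 : (v : ℝ) * (a / v) ^ 2 / 2 - a ^ 2 / (2 * v) = 0 := by field_simp; ring
  have f5 : (v : ℝ) * (b / v) ^ 2 / 2 - b ^ 2 / (2 * v) = 0 := by field_simp; ring
  rw [f1, f2, f3, f4, f5]
  simp
  ring

lemma exp_quad {x : ℝ} (hx : |x| ≤ 1) : Real.exp x ≤ 1 + x + x ^ 2 := by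
  have := (abs_le.mp (Real.abs_exp_sub_one_sub_id_le hx)).2
  linarith

/-- Interpolation error of a Gaussian-smoothed function. -/
lemma interp_err {f : ℝ → ℝ} (hf : Measurable f) (h0 : ∀ x, 0 ≤ f x) (h1 : ∀ x, f x ≤ 1)
    (v : NNReal) (hv : v ≠ 0) (x h θ : ℝ) (hh : 0 < h) (hθ0 : 0 ≤ θ) (hθ1 : θ ≤ 1) :
    |(1 - θ) * smooth f v (x + -(θ * h)) + θ * smooth f v (x + (1 - θ) * h) - smooth f v x|
      ≤ h ^ 2 / v := by
  have hvp : (0 : ℝ) < v := by exact_mod_cast pos_iff_ne_zero.mpr hv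
  set τ := h ^ 2 / (v : ℝ) with hτ
  have hτp : 0 < τ := by positivity
  rcases le_or_gt τ 1 with hle | hgt
  · set a := -(θ * h) with ha
    set b := (1 - θ) * h with hb
    obtain ⟨J, hJ⟩ := W_second v hv a b θ
    have hJle : ∫ y, ((1 - θ) * Real.exp (a / v * y - a ^ 2 / (2 * v))
        + θ * Real.exp (b / v * y - b ^ 2 / (2 * v)) - 1) ^ 2 ∂(gaussianReal 0 v) ≤ τ ^ 2 := by
      rw [hJ]
      have ea : a ^ 2 / v = θ ^ 2 * τ := by rw [ha, hτ]; ring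
      have eb : b ^ 2 / v = (1 - θ) ^ 2 * τ := by rw [hb, hτ]; ring
      have eab : a * b / v = -(θ * (1 - θ)) * τ := by rw [ha, hb, hτ]; ring
      have hθ' : 0 ≤ 1 - θ := by linarith
      have q1 : θ ^ 2 ≤ 1 := by nlinarith
      have q2 : (1 - θ) ^ 2 ≤ 1 := by nlinarith
      have q3 : θ * (1 - θ) ≤ 1 := by nlinarith
      have q4 : 0 ≤ θ * (1 - θ) := mul_nonneg hθ0 hθ'
      have key : ∀ c : ℝ, |c| ≤ 1 → Real.exp (c * τ) ≤ 1 + c * τ + τ ^ 2 := by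
        intro c hc
        have hcτ : |c * τ| ≤ τ := by
          rw [abs_mul, abs_of_pos hτp]
          nlinarith
        have := exp_quad (hcτ.trans hle)
        have : (c * τ) ^ 2 ≤ τ ^ 2 := sq_le_sq' (by linarith [(abs_le.mp hcτ).1]) (abs_le.mp hcτ).2
        linarith
      rw [ea, eb, eab]
      have k1 := key (θ ^ 2) (by rw [abs_of_nonneg (sq_nonneg _)]; exact q1)
      have k2 := key ((1 - θ) ^ 2) (by rw [abs_of_nonneg (sq_nonneg _)]; exact q2)
      have k3 := key (-(θ * (1 - θ))) (by rw [abs_neg, abs_of_nonneg q4]; exact q3)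
      have m1 := mul_le_mul_of_nonneg_left k1 (sq_nonneg (1 - θ))
      have m2 := mul_le_mul_of_nonneg_left k2 (sq_nonneg θ)
      have m3 := mul_le_mul_of_nonneg_left k3 (by nlinarith : 0 ≤ 2 * (1 - θ) * θ)
      nlinarith
    rw [smooth_shift f v hv x a, smooth_shift f v hv x b]
    have If : Integrable (fun y => f (x + y)) (gaussianReal 0 v) :=
      bdd_int (hf.comp (measurable_const_add x)) (fun _ => h0 _) (fun _ => h1 _)
    have IW : ∀ c : ℝ, Integrable
        (fun y => Real.exp (c / v * y - c ^ 2 / (2 * v)) * f (x + y)) (gaussianReal 0 v) := by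
      intro c
      refine (W_int v c).mul_bdd (c := 1)
        (hf.comp (measurable_const_add x)).aestronglyMeasurable
        (Filter.Eventually.of_forall fun y => ?_)
      rw [Real.norm_eq_abs, abs_of_nonneg (h0 _)]
      exact h1 _
    unfold smooth
    have Isum : Integrable (fun y =>
        (1 - θ) * (Real.exp (a / v * y - a ^ 2 / (2 * v)) * f (x + y))
          + θ * (Real.exp (b / v * y - b ^ 2 / (2 * v)) * f (x + y))) (gaussianReal 0 v) :=
      ((IW a).const_mul _).add ((IW b).const_mul _)
    rw [← integral_const_mul, ← integral_const_mul,
      ← integral_add ((IW a).const_mul _) ((IW b).const_mul _),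
      ← integral_sub Isum If, ← Real.norm_eq_abs]
    refine (norm_integral_le_of_norm_le
      (g := fun y => τ / 2 + (1 / (2 * τ)) * ((1 - θ) * Real.exp (a / v * y - a ^ 2 / (2 * v))
        + θ * Real.exp (b / v * y - b ^ 2 / (2 * v)) - 1) ^ 2)
      ((integrable_const _).add (J.const_mul _))
      (Filter.Eventually.of_forall fun y => ?_)).trans ?_
    · skip
      set A := Real.exp (a / v * y - a ^ 2 / (2 * v))
      set B := Real.exp (b / v * y - b ^ 2 / (2 * v))
      have : (1 - θ) * (A * f (x + y)) + θ * (B * f (x + y)) - f (x + y)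
          = ((1 - θ) * A + θ * B - 1) * f (x + y) := by ring
      rw [this, norm_mul, Real.norm_eq_abs, Real.norm_eq_abs, abs_of_nonneg (h0 (x + y))]
      set w := (1 - θ) * A + θ * B - 1
      have s1 : |w| * f (x + y) ≤ |w| := mul_le_of_le_one_right (abs_nonneg _) (h1 _)
      refine s1.trans ?_
      rw [← sq_abs w]
      have : τ / 2 + 1 / (2 * τ) * |w| ^ 2 - |w| = (τ - |w|) ^ 2 / (2 * τ) := by
        field_simp; ring
      have : 0 ≤ (τ - |w|) ^ 2 / (2 * τ) := by positivity
      linarith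
    · rw [integral_add (integrable_const _) (J.const_mul _), integral_const_mul]
      simp only [integral_const, probReal_univ, one_smul]
      have : 1 / (2 * τ) * (∫ y, ((1 - θ) * Real.exp (a / v * y - a ^ 2 / (2 * v))
        + θ * Real.exp (b / v * y - b ^ 2 / (2 * v)) - 1) ^ 2 ∂(gaussianReal 0 v))
          ≤ 1 / (2 * τ) * τ ^ 2 := mul_le_mul_of_nonneg_left hJle (by positivity)
      have e : 1 / (2 * τ) * τ ^ 2 = τ / 2 := by field_simp
      linarith
  · have p := fun z => smooth_nonneg h0 v z
    have q := fun z => smooth_le_one hf h0 h1 v z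
    refine le_trans ?_ hgt.le
    have hθ' : 0 ≤ 1 - θ := by linarith
    rw [abs_le]
    constructor
    · have := mul_nonneg hθ' (p (x + -(θ * h)))
      have := mul_nonneg hθ0 (p (x + (1 - θ) * h))
      linarith [q x]
    · have := mul_le_of_le_one_right hθ' (q (x + -(θ * h)))
      have := mul_le_of_le_one_right hθ0 (q (x + (1 - θ) * h))
      linarith [p x]

lemma smooth_meas {f : ℝ → ℝ} (hf : Measurable f) (v : NNReal) : Measurable (smooth f v) := by
  unfold smooth
  have : StronglyMeasurable (Function.uncurry fun x y : ℝ => f (x + y)) :=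
    (hf.comp (measurable_fst.add measurable_snd)).stronglyMeasurable
  exact this.integral_prod_right.measurable

lemma smooth_smooth {f : ℝ → ℝ} (hf : Measurable f) (h0 : ∀ x, 0 ≤ f x) (h1 : ∀ x, f x ≤ 1)
    (v w : NNReal) (x : ℝ) : smooth (smooth f v) w x = smooth f (w + v) x := by
  have h := gaussianReal_conv_gaussianReal (m₁ := 0) (m₂ := 0) (v₁ := w) (v₂ := v)
  rw [add_zero] at h
  unfold smooth
  rw [← h, integral_conv]
  · simp only [add_assoc]
  · exact bdd_int (hf.comp (measurable_const_add x)) (fun _ => h0 _) (fun _ => h1 _)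

lemma smooth_periodic {f : ℝ → ℝ} (hf : Function.Periodic f 1) (v : NNReal) :
    Function.Periodic (smooth f v) 1 := by
  intro x
  unfold smooth
  congr 1
  ext y
  rw [add_right_comm]
  exact hf _

/-- local error -/
lemma local_err (M : ℕ) [NeZero M] (hM : 2 ≤ M) (j : ZMod M) (v : NNReal) (hv : v ≠ 0) (x : ℝ) :
    |∑ k, hatFn M k x * smooth (hatFn M j) v ((k.val : ℝ) / M) - smooth (hatFn M j) v x|
      ≤ (1 / M : ℝ) ^ 2 / v := by
  have hMpos : (0 : ℝ) < M := by positivity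
  obtain ⟨n, θ, h0, h1, rfl⟩ := exists_cell M x
  rw [sum_hat_cell M hM (fun k => smooth (hatFn M j) v ((k.val : ℝ) / M)) n θ h0 h1]
  have hp := smooth_periodic (hat_periodic M j) v
  rw [node_val M _ hp, node_val M _ hp]
  have := interp_err (hat_meas M j) (hat_nonneg M j) (hat_le_one M j) v hv ((n + θ) / M) (1 / M) θ
    (by positivity) h0 h1.le
  have e1 : ((n : ℝ) + θ) / M + -(θ * (1 / M)) = n / M := by ring
  have e2 : ((n : ℝ) + θ) / M + (1 - θ) * (1 / M) = ((n + 1 : ℤ) : ℝ) / M := by push_cast; ring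
  rwa [e1, e2] at this

lemma Q_smooth (M : ℕ) [NeZero M] (δt : ℝ) (i j : ZMod M) :
    Qmat M δt i j = smooth (hatFn M j) δt.toNNReal ((i.val : ℝ) / M) := rfl

lemma hat_shift_int (M : ℕ) (k : ZMod M) (x : ℝ) (v : NNReal) :
    Integrable (fun y => hatFn M k (x + y)) (gaussianReal 0 v) :=
  bdd_int ((hat_meas M k).comp (measurable_const_add x)) (fun _ => hat_nonneg _ _ _)
    (fun _ => hat_le_one _ _ _)

lemma Q_row (M : ℕ) [NeZero M] (hM : 2 ≤ M) (δt : ℝ) (i : ZMod M) : ∑ k, Qmat M δt i k = 1 := by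
  unfold Qmat
  rw [← integral_finsetSum _ (fun k _ => hat_shift_int M k _ _)]
  simp [sum_hat M hM]

lemma Q_apply (M : ℕ) [NeZero M] (δt : ℝ) (i : ZMod M) (u : ZMod M → ℝ) :
    ∑ k, Qmat M δt i k * u k =
      ∫ y, ∑ k, hatFn M k ((i.val : ℝ) / M + y) * u k ∂(gaussianReal 0 δt.toNNReal) := by
  rw [integral_finsetSum _ (fun k _ => (hat_shift_int M k _ _).mul_const _)]
  simp only [integral_mul_const]
  rfl

lemma step_err (M : ℕ) [NeZero M] (hM : 2 ≤ M) (δt : ℝ) (i j : ZMod M) (v : NNReal)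
    (hv : v ≠ 0) :
    |∑ k, Qmat M δt i k * smooth (hatFn M j) v ((k.val : ℝ) / M)
      - smooth (hatFn M j) (δt.toNNReal + v) ((i.val : ℝ) / M)| ≤ (1 / M : ℝ) ^ 2 / v := by
  rw [Q_apply, ← smooth_smooth (hat_meas M j) (hat_nonneg M j) (hat_le_one M j)]
  conv in smooth (smooth _ _) _ _ => unfold smooth
  change |_ - ∫ y, smooth (hatFn M j) v _ ∂_| ≤ _
  rw [← integral_sub]
  · rw [← Real.norm_eq_abs]
    refine (norm_integral_le_of_norm_le_const
      (Filter.Eventually.of_forall fun y => local_err M hM j v hv _)).trans ?_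
    simp
  · exact integrable_finsetSum _ (fun k _ => (hat_shift_int M k _ _).mul_const _)
  · exact bdd_int ((smooth_meas (hat_meas M j) v).comp (measurable_const_add _))
      (fun _ => smooth_nonneg (hat_nonneg M j) _ _)
      (fun _ => smooth_le_one (hat_meas M j) (hat_nonneg M j) (hat_le_one M j) _ _)

lemma le_Merr (M : ℕ) [NeZero M] (δt : ℝ) (ℓ : ℕ) (i j : ZMod M) :
    |(Qmat M δt ^ ℓ) i j - smooth (hatFn M j) ((ℓ : ℝ) * δt).toNNReal ((i.val : ℝ) / M)|
      ≤ Merr M δt ℓ := by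
  unfold Merr
  refine le_trans ?_ (le_ciSup (Set.finite_range _).bddAbove i)
  exact le_ciSup (f := fun j : ZMod M => |(Qmat M δt ^ ℓ) i j
      - ∫ y, hatFn M j ((i.val : ℝ) / M + y) ∂(gaussianReal 0 ((ℓ : ℝ) * δt).toNNReal)|)
    (Set.finite_range _).bddAbove j

lemma hat_node (M : ℕ) [NeZero M] (hM : 2 ≤ M) (i j : ZMod M) :
    hatFn M j ((i.val : ℝ) / M) = if i = j then 1 else 0 := by
  have := hat_cell M hM j (i.val : ℤ) 0 le_rfl zero_lt_one
  have hk : (((i.val : ℕ) : ℤ) : ZMod M) = i := by simp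
  rw [hk] at this
  rw [add_zero, sub_zero, one_mul, zero_mul, add_zero] at this
  simp only [eq_comm (a := i)]
  rw [← this]
  push_cast
  rfl

/-- One-step growth of the heat-kernel approximation error (formula (4.6)): there is a
constant `C > 0` such that `M_{ℓ+1} ≤ M_ℓ + C δx²/(ℓ δt)` for all `ℓ ≥ 1`; moreover
`M_0 = 0` and `M_1 = 0`. -/
theorem Merr_one_step_growth : ∃ C : ℝ, 0 < C ∧
    ∀ (M : ℕ) [NeZero M], 2 ≤ M → ∀ (δt : ℝ), 0 < δt →
      (∀ ℓ : ℕ, 1 ≤ ℓ →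
        Merr M δt (ℓ + 1) ≤ Merr M δt ℓ + C * (1 / M : ℝ) ^ 2 / ((ℓ : ℝ) * δt)) ∧
      Merr M δt 0 = 0 ∧ Merr M δt 1 = 0 := by
  refine ⟨1, one_pos, ?_⟩
  intro M _ hM δt hδ
  refine ⟨?_, ?_, ?_⟩
  · intro ℓ hℓ
    have hℓ' : (0 : ℝ) < ℓ := by exact_mod_cast hℓ
    have hpos : 0 < (ℓ : ℝ) * δt := by positivity
    have hv : ((ℓ : ℝ) * δt).toNNReal ≠ 0 := by
      rw [Ne, Real.toNNReal_eq_zero, not_le]; exact hpos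
    have hsum : δt.toNNReal + ((ℓ : ℝ) * δt).toNNReal = (((ℓ + 1 : ℕ) : ℝ) * δt).toNNReal := by
      rw [← Real.toNNReal_add hδ.le hpos.le]
      congr 1
      push_cast
      ring
    conv_lhs => unfold Merr
    refine ciSup_le fun i => ciSup_le fun j => ?_
    change |_ - smooth (hatFn M j) _ _| ≤ _
    have hs := step_err M hM δt i j _ hv
    rw [hsum, Real.coe_toNNReal _ hpos.le] at hs
    set v := ((ℓ : ℝ) * δt).toNNReal
    have hd : (Qmat M δt ^ (ℓ + 1)) i j
          - smooth (hatFn M j) (((ℓ + 1 : ℕ) : ℝ) * δt).toNNReal ((i.val : ℝ) / M) =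
        ∑ k, Qmat M δt i k * ((Qmat M δt ^ ℓ) k j - smooth (hatFn M j) v ((k.val : ℝ) / M))
        + (∑ k, Qmat M δt i k * smooth (hatFn M j) v ((k.val : ℝ) / M)
          - smooth (hatFn M j) (((ℓ + 1 : ℕ) : ℝ) * δt).toNNReal ((i.val : ℝ) / M)) := by
      rw [pow_succ', Matrix.mul_apply]
      simp only [mul_sub, Finset.sum_sub_distrib]
      ring
    rw [hd]
    refine (abs_add_le _ _).trans (add_le_add ?_ (by rw [one_mul]; exact hs))
    refine (Finset.abs_sum_le_sum_abs _ _).trans ?_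
    calc _ ≤ ∑ k, Qmat M δt i k * Merr M δt ℓ := by
          refine Finset.sum_le_sum fun k _ => ?_
          have hq : 0 ≤ Qmat M δt i k := smooth_nonneg (hat_nonneg M k) _ _
          rw [abs_mul, abs_of_nonneg hq]
          exact mul_le_mul_of_nonneg_left (le_Merr M δt ℓ k j) hq
      _ = Merr M δt ℓ := by rw [← Finset.sum_mul, Q_row M hM, one_mul]
  · unfold Merr
    simp [-ZMod.natCast_val, gaussianReal_zero_var, hat_node M hM, Matrix.one_apply]
  · unfold Merr
    simp [Qmat]

end
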